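/- Let r ≥ 1. In the ring 𝔉 the identity Σ_{k=1}^{r} (x_k² + x_k·(S_k − S_{k−1}) − S_k·S_{k−1})·(x_k − y_k) = 0 holds; equivalently, the element 𝛃₂ = Σ_{k=1}^r (x_k² + x_k(S_k − S_{k−1}) − S_kS_{k−1})·x̂_k is a cycle in the Koszul complex K(𝔉; x_1 − y_1, …, x_r − y_r). -/

import Mathlib

noncomputable section
open MvPolynomial

/-- The `k`-th elementary symmetric function of a finite family of ring elements:
`e_k(v) = Σ_{S ⊆ ι, |S| = k} Π_{j ∈ S} v j`. -/
def esym {R : Type*} [CommRing R] {ι : Type*} [Fintype ι] [DecidableEq ι]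
    (k : ℕ) (v : ι → R) : R :=
  ∑ S ∈ Finset.univ.powersetCard k, ∏ j ∈ S, v j

/-- The polynomial ring `ℤ[x_1,…,x_r,y_1,…,y_r]`: `Sum.inl` indexes the `x`'s and
`Sum.inr` indexes the `y`'s. -/
abbrev FPoly (r : ℕ) := MvPolynomial (Fin r ⊕ Fin r) ℤ

/-- The relation `e_{j+1}(x) − e_{j+1}(y)` (so the degrees `1,…,r` occur as `j` runs
through `Fin r`). -/
def Frel (r : ℕ) (j : Fin r) : FPoly r :=
  esym ((j : ℕ) + 1) (fun i : Fin r => (X (Sum.inl i) : FPoly r)) -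
    esym ((j : ℕ) + 1) (fun i : Fin r => (X (Sum.inr i) : FPoly r))

/-- The ring `𝔉 = ℤ[x,y]/(e_1(x) − e_1(y), …, e_r(x) − e_r(y))`. -/
abbrev FRing (r : ℕ) := FPoly r ⧸ Ideal.span (Set.range (Frel r))

/-- `x_{j+1}` (zero-based index `j`) in `𝔉`; junk value `0` for `j ≥ r`. -/
def xF (r : ℕ) (j : ℕ) : FRing r :=
  if h : j < r then Ideal.Quotient.mk _ (X (Sum.inl ⟨j, h⟩)) else 0

/-- `y_{j+1}` (zero-based index `j`) in `𝔉`; junk value `0` for `j ≥ r`. -/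
def yF (r : ℕ) (j : ℕ) : FRing r :=
  if h : j < r then Ideal.Quotient.mk _ (X (Sum.inr ⟨j, h⟩)) else 0

/-- `S_m = Σ_{i=1}^m (y_i − x_i) ∈ 𝔉` for `0 ≤ m ≤ r − 1`, with the convention
`S_m = 0` for `m ≥ r` (in particular `S_r = 0`). -/
def SF (r : ℕ) (m : ℕ) : FRing r :=
  if m < r then ∑ j ∈ Finset.range m, (yF r j - xF r j) else 0

/-- Pascal-type recursion for elementary symmetric functions of a multiset. -/
theorem multiset_esymm_cons {R : Type*} [CommRing R] (a : R) (s : Multiset R) (k : ℕ) :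
    (a ::ₘ s).esymm (k + 1) = s.esymm (k + 1) + a * s.esymm k := by
  simp [Multiset.esymm, Multiset.powersetCard_cons, Multiset.map_map, Multiset.sum_map_mul_left]

theorem multiset_esymm_zero {R : Type*} [CommRing R] (s : Multiset R) : s.esymm 0 = 1 := by
  simp [Multiset.esymm]

/-- The elementary symmetric function of degree `k` in `x 0, …, x (n - 1)`. -/
def rangeEsymm {R : Type*} [CommRing R] (x : ℕ → R) (n k : ℕ) : R :=
  ((Multiset.range n).map x).esymm k

theorem rangeEsymm_zero_right {R : Type*} [CommRing R] (x : ℕ → R) (n : ℕ) :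
    rangeEsymm x n 0 = 1 :=
  multiset_esymm_zero _

theorem rangeEsymm_succ {R : Type*} [CommRing R] (x : ℕ → R) (n k : ℕ) :
    rangeEsymm x (n + 1) (k + 1) = rangeEsymm x n (k + 1) + x n * rangeEsymm x n k := by
  rw [rangeEsymm, Multiset.range_succ, Multiset.map_cons, multiset_esymm_cons]
  rfl

theorem rangeEsymm_zero_left {R : Type*} [CommRing R] (x : ℕ → R) (k : ℕ) :
    rangeEsymm x 0 (k + 1) = 0 := by
  simp [rangeEsymm, Multiset.esymm, Multiset.powersetCard_zero_right]

theorem rangeEsymm_one {R : Type*} [CommRing R] (x : ℕ → R) (n : ℕ) :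
    rangeEsymm x n 1 = ∑ j ∈ Finset.range n, x j := by
  induction n with
  | zero => simpa using rangeEsymm_zero_left x 0
  | succ n ih =>
    rw [Finset.sum_range_succ, ← ih, rangeEsymm_succ x n 0, rangeEsymm_zero_right, mul_one]

theorem esym_fin_eq_rangeEsymm {R : Type*} [CommRing R] (r k : ℕ) (x : ℕ → R) :
    esym k (fun i : Fin r => x i) = rangeEsymm x r k := by
  have h : Multiset.range r = (Finset.univ : Finset (Fin r)).val.map Fin.val := by
    have himage : (Finset.univ : Finset (Fin r)).map Fin.valEmbedding = Finset.range r := by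
      ext a
      simp
    rw [← Finset.range_val, ← himage, Finset.map_val]
    rfl
  rw [esym, ← Finset.esymm_map_val, rangeEsymm, h, Multiset.map_map]
  rfl

theorem map_esym {R S : Type*} [CommRing R] [CommRing S] {ι : Type*} [Fintype ι] [DecidableEq ι]
    (f : R →+* S) (k : ℕ) (v : ι → R) : f (esym k v) = esym k (fun i => f (v i)) := by
  simp [esym, map_sum, map_prod]

/-- The defining sum of the cycle, with untruncated partial sums of `y - x`, expressed through
the elementary symmetric functions of degree at most three. -/
theorem sum_cycle_eq {R : Type*} [CommRing R] (x y : ℕ → R) (n : ℕ) :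
    ∑ k ∈ Finset.range n,
        (x k ^ 2 + x k * (∑ j ∈ Finset.range (k + 1), (y j - x j) -
            ∑ j ∈ Finset.range k, (y j - x j)) -
          (∑ j ∈ Finset.range (k + 1), (y j - x j)) * ∑ j ∈ Finset.range k, (y j - x j)) *
          (x k - y k) =
      -(rangeEsymm y n 1 * rangeEsymm x n 1 * (rangeEsymm y n 1 - rangeEsymm x n 1)) +
        rangeEsymm y n 1 * rangeEsymm y n 2 - rangeEsymm x n 1 * rangeEsymm x n 2 -
        rangeEsymm y n 3 + rangeEsymm x n 3 := by
  induction n with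
  | zero =>
    simp [rangeEsymm_zero_left x 0, rangeEsymm_zero_left x 1, rangeEsymm_zero_left x 2,
      rangeEsymm_zero_left y 0, rangeEsymm_zero_left y 1, rangeEsymm_zero_left y 2]
  | succ n ih =>
    rw [Finset.sum_range_succ, ih, Finset.sum_range_succ, Finset.sum_sub_distrib,
      ← rangeEsymm_one, ← rangeEsymm_one]
    simp only [rangeEsymm_succ _ n 0, rangeEsymm_succ _ n 1, rangeEsymm_succ _ n 2,
      rangeEsymm_zero_right, Nat.reduceAdd, zero_add]
    ring

theorem rangeEsymm_xF_eq_yF (r k : ℕ) :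
    rangeEsymm (xF r) r (k + 1) = rangeEsymm (yF r) r (k + 1) := by
  rw [← esym_fin_eq_rangeEsymm, ← esym_fin_eq_rangeEsymm]
  by_cases hk : k < r
  · have h : Ideal.Quotient.mk (Ideal.span (Set.range (Frel r))) (Frel r ⟨k, hk⟩) = 0 :=
      Ideal.Quotient.eq_zero_iff_mem.2 (Ideal.subset_span ⟨_, rfl⟩)
    rw [Frel, map_sub, sub_eq_zero, map_esym, map_esym] at h
    simpa [xF, yF] using h
  · have h : (Finset.univ : Finset (Fin r)).powersetCard (k + 1) = ∅ :=
      Finset.powersetCard_eq_empty.2 (by simp; omega)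
    simp [esym, h]

theorem SF_eq_sum (r m : ℕ) (hm : m ≤ r) :
    SF r m = ∑ j ∈ Finset.range m, (yF r j - xF r j) := by
  rcases hm.lt_or_eq with h | rfl
  · exact if_pos h
  · rw [SF, if_neg (lt_irrefl _), Finset.sum_sub_distrib, ← rangeEsymm_one,
      ← rangeEsymm_one, rangeEsymm_xF_eq_yF m 0, sub_self]

/-- For `r ≥ 1`, in the ring `𝔉` the identity
`Σ_{k=1}^{r} (x_k² + x_k·(S_k − S_{k−1}) − S_k·S_{k−1})·(x_k − y_k) = 0` holds
(zero-based: the summation index below is `k − 1`, so `x_k = xF r k`,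
`S_k = SF r (k+1)`, `S_{k−1} = SF r k`); equivalently, the element
`𝛃₂ = Σ_{k=1}^r (x_k² + x_k(S_k − S_{k−1}) − S_k·S_{k−1})·x̂_k` is a cycle in the
Koszul complex `K(𝔉; x_1 − y_1, …, x_r − y_r)` (the differential of a degree-1
element `Σ c_k x̂_k` is exactly `Σ c_k·(x_k − y_k)`). -/
theorem stmt7 (r : ℕ) (hr : 1 ≤ r) :
    ∑ k ∈ Finset.range r,
        (xF r k ^ 2 + xF r k * (SF r (k + 1) - SF r k) - SF r (k + 1) * SF r k) *
          (xF r k - yF r k) = 0 := by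
  rw [Finset.sum_congr rfl fun k hk => by
    rw [SF_eq_sum r (k + 1) (Finset.mem_range.1 hk), SF_eq_sum r k (Finset.mem_range.1 hk).le]]
  rw [sum_cycle_eq]
  simp only [rangeEsymm_xF_eq_yF r 0, rangeEsymm_xF_eq_yF r 1, rangeEsymm_xF_eq_yF r 2,
    Nat.reduceAdd, zero_add]
  ring
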